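/- Let f : ℝ^d → ℝ be Lipschitz continuous, let δ > 0, and let z be a random vector distributed uniformly on the unit sphere S^{d−1} ⊂ ℝ^d. Then for every x̂ ∈ ℝ^d, the single-shot estimator (d/δ) f(x̂ + δ z) z is an unbiased estimator of the gradient of the δ-smoothed function: E[(d/δ) f(x̂ + δz) z] = ∇f_δ(x̂), where f_δ(x) = vol(B_δ)^{−1} ∫_{‖w‖≤δ} f(x + w) dw is the average of f over the Euclidean ball of radius δ centered at x (and f_δ is differentiable). -/

import Mathlib

open MeasureTheory

namespace SphEst
open Metric Set Filter Topology

lemma charFun_rot {d : ℕ} (ν : Measure (EuclideanSpace ℝ (Fin d)))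
    (hrot : ∀ R : EuclideanSpace ℝ (Fin d) ≃ₗᵢ[ℝ] EuclideanSpace ℝ (Fin d), ν.map R = ν)
    {s t : EuclideanSpace ℝ (Fin d)} (h : ‖s‖ = ‖t‖) : charFun ν s = charFun ν t := by
  set R : EuclideanSpace ℝ (Fin d) ≃ₗᵢ[ℝ] EuclideanSpace ℝ (Fin d) :=
    Submodule.reflection (ℝ ∙ (s - t))ᗮ with hR
  have hRs : R s = t := Submodule.reflection_sub h
  have h1 := hrot R
  rw [charFun_apply, charFun_apply]
  conv_rhs => rw [← h1]
  rw [integral_map R.continuous.measurable.aemeasurable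
    (Continuous.aestronglyMeasurable (by fun_prop))]
  simp [← hRs]

lemma uniq {d : ℕ} (ν σ : Measure (EuclideanSpace ℝ (Fin d)))
    [IsProbabilityMeasure ν] [IsProbabilityMeasure σ]
    (hν : ∀ᵐ z ∂ν, ‖z‖ = 1) (hσ : ∀ᵐ z ∂σ, ‖z‖ = 1)
    (hrν : ∀ R : EuclideanSpace ℝ (Fin d) ≃ₗᵢ[ℝ] EuclideanSpace ℝ (Fin d), ν.map R = ν)
    (hrσ : ∀ R : EuclideanSpace ℝ (Fin d) ≃ₗᵢ[ℝ] EuclideanSpace ℝ (Fin d), σ.map R = σ) :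
    ν = σ := by
  apply Measure.ext_of_charFun
  ext t
  have h1 : charFun ν t = ∫ u, charFun ν (‖t‖ • u) ∂σ := by
    have : ∫ u, charFun ν (‖t‖ • u) ∂σ = ∫ u, charFun ν t ∂σ := by
      apply integral_congr_ae
      filter_upwards [hσ] with u hu
      exact charFun_rot ν hrν (by simp [norm_smul, hu])
    rw [this]; simp
  have h2 : charFun σ t = ∫ u, charFun σ (‖t‖ • u) ∂ν := by
    have : ∫ u, charFun σ (‖t‖ • u) ∂ν = ∫ u, charFun σ t ∂ν := by
      apply integral_congr_ae
      filter_upwards [hν] with u hu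
      exact charFun_rot σ hrσ (by simp [norm_smul, hu])
    rw [this]; simp
  rw [h1, h2]
  simp only [charFun_apply]
  rw [integral_integral_swap]
  · congr 1; ext u; congr 1; ext z
    rw [inner_smul_right, inner_smul_right, real_inner_comm]
  · apply Integrable.of_bound (C := 1)
    · exact Continuous.aestronglyMeasurable (by simp only [Function.uncurry_def]; fun_prop)
    · refine Eventually.of_forall fun p => ?_
      simp only [Function.uncurry_def]
      rw [Complex.norm_exp_ofReal_mul_I]

lemma annulus {d : ℕ} (ν : Measure (EuclideanSpace ℝ (Fin d)))
    [IsProbabilityMeasure ν] 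
    (hν : ∀ᵐ z ∂ν, ‖z‖ = 1) 
    (hrν : ∀ R : EuclideanSpace ℝ (Fin d) ≃ₗᵢ[ℝ] EuclideanSpace ℝ (Fin d), ν.map R = ν)
    (a b : ℝ) (ha : 0 < a) (h : EuclideanSpace ℝ (Fin d) → ℝ) (hh : Continuous h)
    (A : Set (EuclideanSpace ℝ (Fin d))) (hA : A = ball 0 b \ closedBall 0 a) :
    ∫ w in A, h (‖w‖⁻¹ • w) = volume.real A * ∫ z, h z ∂ν := by
  have hAm : MeasurableSet A := by rw [hA]; measurability
  have hfin : volume A ≠ ⊤ := by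
    rw [hA]
    exact ((measure_mono sdiff_subset).trans_lt measure_ball_lt_top).ne
  by_cases h0 : volume A = 0
  · simp [Measure.restrict_eq_zero.2 h0, measureReal_def, h0]
  have hp : IsProbabilityMeasure (ProbabilityTheory.cond volume A) :=
    ProbabilityTheory.cond_isProbabilityMeasure_of_finite h0 hfin
  have hm : Measurable (fun w : EuclideanSpace ℝ (Fin d) => ‖w‖⁻¹ • w) := by fun_prop
  set σ := (ProbabilityTheory.cond volume A).map (fun w : EuclideanSpace ℝ (Fin d) => ‖w‖⁻¹ • w) with hσ
  have : IsProbabilityMeasure σ := Measure.isProbabilityMeasure_map hm.aemeasurable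
  have key : ν = σ := by
    apply uniq ν σ hν _ hrν
    · intro R
      have hRm : Measurable R := R.continuous.measurable
      rw [hσ, Measure.map_map hRm hm]
      have e : (R ∘ fun w : EuclideanSpace ℝ (Fin d) => ‖w‖⁻¹ • w) = (fun w => ‖w‖⁻¹ • w) ∘ R := by
        ext1 w; simp
      rw [e, ← Measure.map_map hm hRm]
      congr 1
      rw [ProbabilityTheory.cond, Measure.map_smul]
      congr 1
      have hpre : R ⁻¹' A = A := by ext w; simp [hA]
      have := (R.measurePreserving.restrict_preimage hAm).map_eq
      rw [hpre] at this
      exact this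
    · rw [hσ, ae_map_iff hm.aemeasurable (measurableSet_eq_fun (by fun_prop) (by fun_prop))]
      have : ∀ᵐ w ∂(ProbabilityTheory.cond volume A), w ∈ A := by
        apply ProbabilityTheory.ae_cond_mem hAm
      filter_upwards [this] with w hw
      rw [hA] at hw
      have : 0 < ‖w‖ := by simp at hw; linarith
      rw [norm_smul]; simp; field_simp
  rw [key, hσ, integral_map hm.aemeasurable hh.aestronglyMeasurable, ProbabilityTheory.cond,
    integral_smul_measure, measureReal_def, smul_eq_mul, ENNReal.toReal_inv, mul_inv_cancel_left₀]
  exact ENNReal.toReal_ne_zero.2 ⟨h0, hfin⟩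

/-- cutoff -/
noncomputable def cut {d : ℕ} (δ N : ℝ) (w : EuclideanSpace ℝ (Fin d)) : ℝ :=
  max 0 (min 1 (1 - N * (‖w‖ - δ)))

lemma cut_lip {d : ℕ} (δ N : ℝ) : 
    LipschitzWith (Real.nnabs N) (cut δ N : EuclideanSpace ℝ (Fin d) → ℝ) := by
  have h : LipschitzWith (Real.nnabs N) (fun w : EuclideanSpace ℝ (Fin d) => 1 - N * (‖w‖ - δ)) := by
    apply LipschitzWith.of_dist_le_mul
    intro x y
    rw [Real.dist_eq, dist_eq_norm]
    have : 1 - N * (‖x‖ - δ) - (1 - N * (‖y‖ - δ)) = -(N * (‖x‖ - ‖y‖)) := by ring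
    rw [this, abs_neg, abs_mul]
    simp only [Real.coe_nnabs]
    gcongr
    exact abs_norm_sub_norm_le x y
  exact (h.const_min 1).const_max 0

lemma cut_zero {d : ℕ} (δ N : ℝ) (hN : 0 < N) (w : EuclideanSpace ℝ (Fin d)) (hw : δ + N⁻¹ ≤ ‖w‖) : 
    cut δ N w = 0 := by
  have : 1 ≤ N * (‖w‖ - δ) := by
    have := mul_le_mul_of_nonneg_left (show N⁻¹ ≤ ‖w‖ - δ by linarith) hN.le
    rwa [mul_inv_cancel₀ hN.ne'] at this
  unfold cut
  rw [max_eq_left]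
  exact (min_le_right _ _).trans (by linarith)

lemma cut_one {d : ℕ} (δ N : ℝ) (hN : 0 < N) (w : EuclideanSpace ℝ (Fin d)) (hw : ‖w‖ ≤ δ) : 
    cut δ N w = 1 := by
  have : N * (‖w‖ - δ) ≤ 0 := mul_nonpos_of_nonneg_of_nonpos hN.le (by linarith)
  unfold cut
  rw [min_eq_left (by linarith), max_eq_right (by norm_num)]

lemma cut_mid {d : ℕ} (δ N : ℝ) (hN : 0 < N) (w : EuclideanSpace ℝ (Fin d)) (hw : δ ≤ ‖w‖) 
    (hw' : ‖w‖ ≤ δ + N⁻¹) : cut δ N w = 1 - N * (‖w‖ - δ) := by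
  have h1 : 0 ≤ N * (‖w‖ - δ) := mul_nonneg hN.le (by linarith)
  have : N * (‖w‖ - δ) ≤ 1 := by
    have := mul_le_mul_of_nonneg_left (show ‖w‖ - δ ≤ N⁻¹ by linarith) hN.le
    rwa [mul_inv_cancel₀ hN.ne'] at this
  unfold cut
  rw [min_eq_right (by linarith), max_eq_right (by linarith)]

lemma cut_compact {d : ℕ} (δ N : ℝ) (hN : 0 < N) : 
    HasCompactSupport (cut δ N : EuclideanSpace ℝ (Fin d) → ℝ) := by
  apply HasCompactSupport.intro (isCompact_closedBall 0 (δ + N⁻¹))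
  intro x hx
  apply cut_zero δ N hN
  simp at hx; exact hx.le

lemma cut_lineDeriv {d : ℕ} (δ N : ℝ) (hδ : 0 < δ) (hN : 0 < N) (v : EuclideanSpace ℝ (Fin d)) :
    ∀ᵐ w : EuclideanSpace ℝ (Fin d), lineDeriv ℝ (cut δ N) w (-v) =
      (ball 0 (δ + N⁻¹) \ closedBall 0 δ).indicator (fun w => N * inner ℝ (‖w‖⁻¹ • w) v) w := by
  have hi : 0 < N⁻¹ := inv_pos.2 hN
  have s1 : volume (sphere (0 : EuclideanSpace ℝ (Fin d)) δ) = 0 :=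
    Measure.addHaar_sphere_of_ne_zero _ _ hδ.ne'
  have s2 : volume (sphere (0 : EuclideanSpace ℝ (Fin d)) (δ + N⁻¹)) = 0 :=
    Measure.addHaar_sphere_of_ne_zero _ _ (by positivity)
  filter_upwards [measure_eq_zero_iff_ae_notMem.1 s1, measure_eq_zero_iff_ae_notMem.1 s2] with w h1 h2
  simp only [mem_sphere_iff_norm, sub_zero] at h1 h2
  rcases lt_or_gt_of_ne h1 with h | h
  · rw [indicator_of_notMem (by simp [h.le])]
    have : cut δ N =ᶠ[𝓝 w] fun _ => (1 : ℝ) := by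
      filter_upwards [(continuous_norm.isOpen_preimage _ isOpen_Iio).mem_nhds (show w ∈ norm ⁻¹' Iio δ from h)] with x hx
      exact cut_one δ N hN x (le_of_lt hx)
    rw [this.lineDeriv_eq]; simp [lineDeriv]
  rcases lt_or_gt_of_ne h2 with h' | h'
  · rw [indicator_of_mem (by simp [h, h'])]
    have e : cut δ N =ᶠ[𝓝 w] fun x => 1 - N * (‖x‖ - δ) := by
      filter_upwards [(continuous_norm.isOpen_preimage _ isOpen_Ioo).mem_nhds (show w ∈ norm ⁻¹' Ioo δ (δ + N⁻¹) from ⟨h, h'⟩)] with x hx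
      exact cut_mid δ N hN x hx.1.le hx.2.le
    rw [e.lineDeriv_eq]
    have hw : w ≠ 0 := by rintro rfl; simp at h; linarith
    have hnw : 0 < ‖w‖ := norm_pos_iff.2 hw
    rw [lineDeriv]
    have hd1 : HasDerivAt (fun t : ℝ => w + t • -v) (-v) 0 := by
      simpa using ((hasDerivAt_id (0:ℝ)).smul_const (-v)).const_add w
    have hd2 := hd1.norm_sq.sqrt (by simpa using hw)
    have hd3 := (((hd2.sub_const δ).const_mul N).const_sub 1)
    simp only [Real.sqrt_sq (norm_nonneg _)] at hd3
    rw [hd3.deriv]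
    simp [inner_smul_left]
    field_simp
  · rw [indicator_of_notMem (by simp [h'.le])]
    have : cut δ N =ᶠ[𝓝 w] fun _ => (0 : ℝ) := by
      filter_upwards [(continuous_norm.isOpen_preimage _ isOpen_Ioi).mem_nhds (show w ∈ norm ⁻¹' Ioi (δ + N⁻¹) from h')] with x hx
      exact cut_zero δ N hN x (le_of_lt hx)
    rw [this.lineDeriv_eq]; simp [lineDeriv]

lemma ibp {d : ℕ} (g : EuclideanSpace ℝ (Fin d) → ℝ) (L : NNReal) (hg : LipschitzWith L g)
    (δ N : ℝ) (hδ : 0 < δ) (hN : 0 < N) (v : EuclideanSpace ℝ (Fin d)) :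
    ∫ w, lineDeriv ℝ g w v * cut δ N w =
     N * ∫ w in (ball 0 (δ + N⁻¹) \ closedBall 0 δ), inner ℝ (‖w‖⁻¹ • w) v * g w := by
  rw [hg.integral_lineDeriv_mul_eq (cut_lip δ N) (cut_compact δ N hN), ← integral_const_mul,
    ← integral_indicator (by measurability)]
  apply integral_congr_ae
  filter_upwards [cut_lineDeriv δ N hδ hN v] with w hw
  rw [hw]
  by_cases h : w ∈ (ball 0 (δ + N⁻¹) \ closedBall 0 δ)
  · rw [indicator_of_mem h, indicator_of_mem h]; ring
  · rw [indicator_of_notMem h, indicator_of_notMem h]; ring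

lemma lim1 {d : ℕ} (g : EuclideanSpace ℝ (Fin d) → ℝ) (L : NNReal) (hg : LipschitzWith L g)
    (δ : ℝ) (v : EuclideanSpace ℝ (Fin d)) :
    Tendsto (fun n : ℕ => ∫ w, lineDeriv ℝ g w v * cut δ ((n : ℝ) + 1) w) atTop
      (𝓝 (∫ w in closedBall 0 δ, lineDeriv ℝ g w v)) := by
  rw [← integral_indicator measurableSet_closedBall]
  apply tendsto_integral_of_dominated_convergence
    ((closedBall (0 : EuclideanSpace ℝ (Fin d)) (δ + 1)).indicator fun _ => (L : ℝ) * ‖v‖)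
  · intro n
    exact ((measurable_lineDeriv hg.continuous).mul
      (cut_lip _ _).continuous.measurable).aestronglyMeasurable
  · rw [integrable_indicator_iff measurableSet_closedBall]
    exact integrableOn_const measure_closedBall_lt_top.ne
  · intro n
    have hn : (0 : ℝ) < n + 1 := by positivity
    refine Eventually.of_forall fun w => ?_
    by_cases h : w ∈ closedBall (0 : EuclideanSpace ℝ (Fin d)) (δ + 1)
    · rw [indicator_of_mem h, norm_mul, ← mul_one ((L : ℝ) * ‖v‖)]
      gcongr
      · exact norm_lineDeriv_le_of_lipschitz ℝ hg
      · rw [Real.norm_eq_abs, abs_le, cut]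
        constructor
        · linarith [le_max_left 0 (min 1 (1 - ((n : ℝ) + 1) * (‖w‖ - δ)))]
        · exact max_le (by norm_num) (min_le_left _ _)
    · rw [indicator_of_notMem h, cut_zero]
      · simp
      · exact hn
      · simp at h
        have : ((n : ℝ) + 1)⁻¹ ≤ 1 := inv_le_one_of_one_le₀ (by linarith [Nat.cast_nonneg (α := ℝ) n])
        linarith
  · refine Eventually.of_forall fun w => ?_
    by_cases h : w ∈ closedBall (0 : EuclideanSpace ℝ (Fin d)) δ
    · rw [indicator_of_mem h]
      have : ∀ n : ℕ, cut δ ((n : ℝ) + 1) w = 1 := fun n =>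
        cut_one _ _ (by positivity) _ (by simpa using h)
      simp [this]
    · rw [indicator_of_notMem h]
      simp at h
      apply tendsto_const_nhds.congr'
      have := (tendsto_one_div_add_atTop_nhds_zero_nat (𝕜 := ℝ)).eventually_lt_const (sub_pos.2 h)
      filter_upwards [this] with n hn
      rw [cut_zero, mul_zero]
      · positivity
      · rw [one_div] at hn; linarith

lemma vol_ann {d : ℕ} (δ : ℝ) (hδ : 0 < δ) :
    Tendsto (fun n : ℕ => ((n : ℝ) + 1) * volume.real 
      (ball (0 : EuclideanSpace ℝ (Fin d)) (δ + ((n : ℝ) + 1)⁻¹) \ closedBall 0 δ)) atTop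
      (𝓝 (d * δ ^ (d - 1) * volume.real (ball (0 : EuclideanSpace ℝ (Fin d)) 1))) := by
  have h1 : HasDerivAt (fun x : ℝ => x ^ d) (d * δ ^ (d - 1)) δ := hasDerivAt_pow d δ
  have h2 := h1.tendsto_slope_zero_right
  have h3 : Tendsto (fun n : ℕ => ((n : ℝ) + 1)⁻¹) atTop (𝓝[>] 0) := by
    rw [tendsto_nhdsWithin_iff]
    refine ⟨by simpa using tendsto_one_div_add_atTop_nhds_zero_nat (𝕜 := ℝ), ?_⟩
    exact Eventually.of_forall fun n => by simp only [mem_Ioi]; positivity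
  refine ((h2.comp h3).mul_const _).congr fun n => ?_
  have hp : (0 : ℝ) < ((n : ℝ) + 1)⁻¹ := by positivity
  have hball : volume.real (ball (0 : EuclideanSpace ℝ (Fin d)) (δ + ((n : ℝ) + 1)⁻¹)) =
      (δ + ((n : ℝ) + 1)⁻¹) ^ Module.finrank ℝ (EuclideanSpace ℝ (Fin d)) *
        volume.real (ball (0 : EuclideanSpace ℝ (Fin d)) 1) := by
    have hpos : 0 < δ + ((n : ℝ) + 1)⁻¹ := by positivity
    rw [measureReal_def, Measure.addHaar_ball_of_pos _ _ hpos, ENNReal.toReal_mul,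
      ENNReal.toReal_ofReal (by positivity), measureReal_def]
  rw [measureReal_sdiff (closedBall_subset_ball (by linarith)) measurableSet_closedBall,
    hball, Measure.addHaar_real_closedBall _ _ hδ.le]
  simp
  ring


lemma lim2 {d : ℕ} (ν : Measure (EuclideanSpace ℝ (Fin d)))
    [IsProbabilityMeasure ν] (hν : ∀ᵐ z ∂ν, ‖z‖ = 1)
    (hrν : ∀ R : EuclideanSpace ℝ (Fin d) ≃ₗᵢ[ℝ] EuclideanSpace ℝ (Fin d), ν.map R = ν)
    (g : EuclideanSpace ℝ (Fin d) → ℝ) (L : NNReal) (hg : LipschitzWith L g)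
    (δ : ℝ) (hδ : 0 < δ) (v : EuclideanSpace ℝ (Fin d)) :
    Tendsto (fun n : ℕ => ((n : ℝ) + 1) *
      ∫ w in (ball 0 (δ + ((n : ℝ) + 1)⁻¹) \ closedBall 0 δ), inner ℝ (‖w‖⁻¹ • w) v * g w) atTop
      (𝓝 (d * δ ^ (d - 1) * volume.real (ball (0 : EuclideanSpace ℝ (Fin d)) 1) *
        ∫ z, inner ℝ z v * g (δ • z) ∂ν)) := by
  have hgc := hg.continuous
  have hv := vol_ann (d := d) δ hδ
  have hlim := hv.mul_const (∫ z, inner ℝ z v * g (δ • z) ∂ν)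
  have hN0 : Tendsto (fun n : ℕ => ((n : ℝ) + 1)⁻¹) atTop (𝓝 0) := by
    simpa using tendsto_one_div_add_atTop_nhds_zero_nat (𝕜 := ℝ)
  have herr := (hv.mul_const (‖v‖ * L)).mul hN0
  rw [mul_zero] at herr
  rw [tendsto_iff_norm_sub_tendsto_zero] at hlim ⊢
  have hsum := herr.add hlim
  rw [add_zero] at hsum
  refine squeeze_zero (fun n => norm_nonneg _) (fun n => ?_) hsum
  set A := (ball (0 : EuclideanSpace ℝ (Fin d)) (δ + ((n : ℝ) + 1)⁻¹) \ closedBall 0 δ) with hA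
  have hn : (0 : ℝ) < (n : ℝ) + 1 := by positivity
  have hAm : MeasurableSet A := by rw [hA]; measurability
  have hfin : volume A < ⊤ := (measure_mono sdiff_subset).trans_lt measure_ball_lt_top
  have hann := annulus ν hν hrν δ (δ + ((n : ℝ) + 1)⁻¹) hδ (fun z => inner ℝ z v * g (δ • z))
    (by fun_prop) A hA
  have hnorm : ∀ w ∈ A, ‖(‖w‖⁻¹ • w)‖ = 1 ∧ ‖w - δ • (‖w‖⁻¹ • w)‖ ≤ ((n : ℝ) + 1)⁻¹ := by
    intro w hw
    simp only [hA, Set.mem_sdiff, mem_ball, mem_closedBall, dist_zero_right, not_le] at hw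
    have h0 : 0 < ‖w‖ := hδ.trans hw.2
    refine ⟨by rw [norm_smul]; simp; field_simp, ?_⟩
    have : w - δ • (‖w‖⁻¹ • w) = (1 - δ * ‖w‖⁻¹) • w := by rw [sub_smul, one_smul, smul_smul]
    rw [this, norm_smul, Real.norm_eq_abs, abs_of_nonneg]
    · have : (1 - δ * ‖w‖⁻¹) * ‖w‖ = ‖w‖ - δ := by field_simp
      linarith [hw.1]
    · rw [sub_nonneg, ← div_eq_mul_inv, div_le_one h0]; exact hw.2.le
  have hinner : ∀ w ∈ A, |inner ℝ (‖w‖⁻¹ • w) v| ≤ ‖v‖ := by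
    intro w hw
    have := abs_real_inner_le_norm (‖w‖⁻¹ • w) v
    rwa [(hnorm w hw).1, one_mul] at this
  have hgb : ∀ w ∈ A, |g w - g (δ • (‖w‖⁻¹ • w))| ≤ L * ((n : ℝ) + 1)⁻¹ := by
    intro w hw
    have := hg.norm_sub_le w (δ • (‖w‖⁻¹ • w))
    rw [Real.norm_eq_abs] at this
    exact this.trans (by gcongr; exact (hnorm w hw).2)
  have hbd : ∃ C, ∀ w ∈ closedBall (0 : EuclideanSpace ℝ (Fin d)) (δ + ((n : ℝ) + 1)⁻¹), ‖g w‖ ≤ C :=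
    (isCompact_closedBall _ _).exists_bound_of_continuousOn hgc.continuousOn
  obtain ⟨C, hC⟩ := hbd
  have hI1 : IntegrableOn (fun w => inner ℝ (‖w‖⁻¹ • w) v * g w) A := by
    apply Measure.integrableOn_of_bounded (M := ‖v‖ * C) hfin.ne
    · exact Measurable.aestronglyMeasurable (by have := hgc.measurable; fun_prop)
    · filter_upwards [ae_restrict_mem hAm] with w hw
      rw [norm_mul]
      gcongr
      · exact hinner w hw
      · exact hC w (ball_subset_closedBall hw.1)
  have hI2 : IntegrableOn (fun w => inner ℝ (‖w‖⁻¹ • w) v * g (δ • (‖w‖⁻¹ • w))) A := by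
    apply Measure.integrableOn_of_bounded (M := ‖v‖ * C) hfin.ne
    · exact Measurable.aestronglyMeasurable (by have := hgc.measurable; fun_prop)
    · filter_upwards [ae_restrict_mem hAm] with w hw
      rw [norm_mul]
      gcongr
      · exact hinner w hw
      · apply hC
        rw [mem_closedBall_zero_iff, norm_smul, (hnorm w hw).1, Real.norm_eq_abs, abs_of_pos hδ]
        have : 0 < ((n : ℝ) + 1)⁻¹ := by positivity
        linarith
  have hdiff : ‖(∫ w in A, inner ℝ (‖w‖⁻¹ • w) v * g w) -
      volume.real A * ∫ z, inner ℝ z v * g (δ • z) ∂ν‖ ≤ 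
      (‖v‖ * (L * ((n : ℝ) + 1)⁻¹)) * volume.real A := by
    rw [← hann, ← integral_sub hI1 hI2]
    apply norm_setIntegral_le_of_norm_le_const hfin
    intro w hw
    rw [← mul_sub, norm_mul]
    gcongr
    · exact hinner w hw
    · exact hgb w hw
  have e : ∀ a b c k : ℝ, k * a - c = k * (a - b) + (k * b - c) := by intros; ring
  rw [e _ (volume.real A * ∫ z, inner ℝ z v * g (δ • z) ∂ν)]
  refine (norm_add_le _ _).trans (add_le_add ?_ (le_of_eq ?_))
  · rw [norm_mul, Real.norm_of_nonneg hn.le]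
    calc _ ≤ _ := mul_le_mul_of_nonneg_left hdiff hn.le
      _ = _ := by ring
  · congr 2; ring

lemma divergence {d : ℕ} (ν : Measure (EuclideanSpace ℝ (Fin d)))
    [IsProbabilityMeasure ν] (hν : ∀ᵐ z ∂ν, ‖z‖ = 1)
    (hrν : ∀ R : EuclideanSpace ℝ (Fin d) ≃ₗᵢ[ℝ] EuclideanSpace ℝ (Fin d), ν.map R = ν)
    (g : EuclideanSpace ℝ (Fin d) → ℝ) (L : NNReal) (hg : LipschitzWith L g)
    (δ : ℝ) (hδ : 0 < δ) (v : EuclideanSpace ℝ (Fin d)) :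
    ∫ w in closedBall 0 δ, lineDeriv ℝ g w v =
      d * δ ^ (d - 1) * volume.real (ball (0 : EuclideanSpace ℝ (Fin d)) 1) *
        ∫ z, inner ℝ z v * g (δ • z) ∂ν := by
  refine tendsto_nhds_unique (lim1 g L hg δ v) ((lim2 ν hν hrν g L hg δ hδ v).congr fun n => ?_)
  rw [ibp g L hg δ _ hδ (by positivity)]

end SphEst

theorem spherical_estimator_unbiased
    {d : ℕ} (hd : 0 < d)
    (f : EuclideanSpace ℝ (Fin d) → ℝ) (Lf : NNReal) (hf : LipschitzWith Lf f)
    (δ : ℝ) (hδ : 0 < δ)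
    (ν : Measure (EuclideanSpace ℝ (Fin d))) [IsProbabilityMeasure ν]
    (hsphere : ν (Metric.sphere (0 : EuclideanSpace ℝ (Fin d)) 1) = 1)
    (hrot : ∀ R : EuclideanSpace ℝ (Fin d) ≃ₗᵢ[ℝ] EuclideanSpace ℝ (Fin d),
      ν.map R = ν)
    (xhat : EuclideanSpace ℝ (Fin d)) :
    HasGradientAt
      (fun x => ((volume (Metric.closedBall (0 : EuclideanSpace ℝ (Fin d)) δ)).toReal)⁻¹ *
        ∫ w in Metric.closedBall (0 : EuclideanSpace ℝ (Fin d)) δ, f (x + w))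
      (∫ z, (((d : ℝ) / δ) * f (xhat + δ • z)) • z ∂ν) xhat := by
  have hfc := hf.continuous
  have hν : ∀ᵐ z ∂ν, ‖z‖ = 1 := by
    have : ∀ᵐ z ∂ν, z ∈ Metric.sphere (0 : EuclideanSpace ℝ (Fin d)) 1 :=
      (prob_compl_eq_zero_iff Metric.isClosed_sphere.measurableSet).2 hsphere
    filter_upwards [this] with z hz
    simpa using hz
  set g : EuclideanSpace ℝ (Fin d) → ℝ := fun w => f (xhat + w) with hgdef
  have hg : LipschitzWith Lf g := by
    apply LipschitzWith.of_dist_le_mul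
    intro x y
    simpa using hf.dist_le_mul (xhat + x) (xhat + y)
  have hfin : volume (Metric.closedBall (0 : EuclideanSpace ℝ (Fin d)) δ) < ⊤ :=
    measure_closedBall_lt_top
  obtain ⟨hint, hder⟩ := hasFDerivAt_integral_of_dominated_loc_of_lip
    (μ := volume.restrict (Metric.closedBall (0 : EuclideanSpace ℝ (Fin d)) δ))
    (F := fun x w => f (x + w)) (F' := fun w => fderiv ℝ g w) (x₀ := xhat) (s := Set.univ)
    (bound := fun _ => (Lf : ℝ)) (𝕜 := ℝ) Filter.univ_mem
    (Filter.Eventually.of_forall fun x => Continuous.aestronglyMeasurable (by fun_prop))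
    ((Continuous.continuousOn (by fun_prop)).integrableOn_compact (isCompact_closedBall _ _))
    (measurable_fderiv ℝ g).aestronglyMeasurable
    (Filter.Eventually.of_forall fun w => by
      apply LipschitzWith.lipschitzOnWith
      apply LipschitzWith.of_dist_le_mul
      intro x y
      simpa using hf.dist_le_mul (x + w) (y + w))
    (integrableOn_const hfin.ne)
    (by
      filter_upwards [ae_restrict_of_ae hg.ae_differentiableAt] with w hw
      have h1 := hw.hasFDerivAt
      have h2 : HasFDerivAt f (fderiv ℝ g w) (xhat + w) := by
        have h3 : HasFDerivAt g (fderiv ℝ g w) (-xhat + (xhat + w)) := by simpa using h1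
        have h4 := (hasFDerivAt_comp_add_left (f := g) (x := xhat + w) (-xhat)).2 h3
        simpa [hgdef] using h4
      exact (hasFDerivAt_comp_add_right w).2 h2)
  have hder2 := hder.const_mul ((volume (Metric.closedBall (0 : EuclideanSpace ℝ (Fin d)) δ)).toReal)⁻¹
  rw [hasGradientAt_iff_hasFDerivAt]
  refine hder2.congr_fderiv ?_
  symm
  ext v
  have hdiv := SphEst.divergence ν hν hrot g Lf hg δ hδ v
  have hlin : ∫ w in Metric.closedBall 0 δ, lineDeriv ℝ g w v =
      ∫ w in Metric.closedBall 0 δ, fderiv ℝ g w v := by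
    apply integral_congr_ae
    filter_upwards [ae_restrict_of_ae hg.ae_differentiableAt] with w hw
    exact hw.lineDeriv_eq_fderiv
  have hgc : Continuous g := hg.continuous
  obtain ⟨C, hC⟩ := (isCompact_sphere (0 : EuclideanSpace ℝ (Fin d)) 1).exists_bound_of_continuousOn
    (f := fun z => (((d : ℝ) / δ) * f (xhat + δ • z)) • z) (Continuous.continuousOn (by fun_prop))
  have hI : Integrable (fun z => (((d : ℝ) / δ) * f (xhat + δ • z)) • z) ν := by
    apply Integrable.of_bound (C := C) (Continuous.aestronglyMeasurable (by fun_prop))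
    filter_upwards [hν] with z hz
    exact hC z (by simpa using hz)
  rw [InnerProductSpace.toDual_apply_apply, real_inner_comm, ← integral_inner hI]
  rw [ContinuousLinearMap.smul_apply, ContinuousLinearMap.integral_apply hint, ← hlin, hdiv]
  have e1 : ∀ z, inner ℝ v ((((d : ℝ) / δ) * f (xhat + δ • z)) • z) =
      ((d : ℝ) / δ) * (inner ℝ z v * g (δ • z)) := by
    intro z
    rw [inner_smul_right, real_inner_comm, hgdef]; ring
  simp only [e1]
  rw [integral_const_mul, ← measureReal_def, Measure.addHaar_real_closedBall _ _ hδ.le, smul_eq_mul]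
  have hV : 0 < volume.real (Metric.ball (0 : EuclideanSpace ℝ (Fin d)) 1) :=
    ENNReal.toReal_pos (Metric.measure_ball_pos _ _ one_pos).ne' measure_ball_lt_top.ne
  have hpow : δ ^ d = δ ^ (d - 1) * δ := by
    rw [← pow_succ, Nat.sub_add_cancel hd]
  simp only [finrank_euclideanSpace, Fintype.card_fin]
  rw [hpow]
  field_simp
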